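/- Let c = c₁c₂ with gcd(c₁,c₂) = 1. Let N₁ = ∏_{p | c₁} p^{ν_p(N_β)} (product over primes p dividing c₁, ν_p the p-adic valuation) and N₂ = N_β/N₁, and write χ = χ₁χ₂ where χ₁ is a Dirichlet character mod N₁ and χ₂ is a Dirichlet character mod N₂ (this factorization exists and is unique since gcd(N₁,N₂) = 1). Then G_{γ,n}(c; β, χ) = χ₁(N₂c₂) · χ₂(N₁c₁) · G_{γ,n}(c₁; N₂β, χ₁) · G_{γ,n}(c₂; N₁β, χ₂), where N₂β and N₁β are isotropic elements of L' of orders N₁ and N₂ respectively. -/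

import Mathlib

open Finset Matrix

namespace EisensteinWeil

variable {m : ℕ}

/-- The bilinear form `(x,y) = xᵀ S y` on `ℚ^m`. -/
def bil (S : Matrix (Fin m) (Fin m) ℤ) (x y : Fin m → ℚ) : ℚ :=
  x ⬝ᵥ (S.map (Int.cast : ℤ → ℚ)).mulVec y

/-- The quadratic form `Q(x) = (x,x)/2`. -/
def Qf (S : Matrix (Fin m) (Fin m) ℤ) (x : Fin m → ℚ) : ℚ := bil S x x / 2

/-- Membership in the dual lattice `L' = S⁻¹ℤ^m`: `x ∈ L'` iff `(x,r) ∈ ℤ` for all `r ∈ ℤ^m`. -/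
def memDual (S : Matrix (Fin m) (Fin m) ℤ) (γ : Fin m → ℚ) : Prop :=
  ∀ r : Fin m → ℤ, ∃ z : ℤ, bil S γ (fun i => (r i : ℚ)) = z

/-- `N` is the order of `γ + ℤ^m` in `L'/ℤ^m`, i.e. the smallest positive integer with
`N • γ ∈ ℤ^m`. -/
def isOrderOf (γ : Fin m → ℚ) (N : ℕ) : Prop :=
  0 < N ∧ (∀ i, ∃ z : ℤ, (N : ℚ) * γ i = z) ∧
    ∀ k : ℕ, 0 < k → (∀ i, ∃ z : ℤ, (k : ℚ) * γ i = z) → N ≤ k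

/-- The representation number `N_{γ,n}(a)`, counting `r ∈ (ℤ^m)/(aℤ^m)`
(represented by `r : Fin m → Fin a`) with `Q(r − γ) + n ≡ 0 (mod a)`. -/
noncomputable def repNum (S : Matrix (Fin m) (Fin m) ℤ) (γ : Fin m → ℚ) (n : ℚ) (a : ℕ) : ℕ :=
  Nat.card {r : Fin m → Fin a //
    ∃ t : ℤ, Qf S ((fun i => ((r i : ℕ) : ℚ)) - γ) + n = (a : ℚ) * t}

/-- `e(x) = e^{2πix}`. -/
noncomputable def eQ (x : ℚ) : ℂ := Complex.exp (2 * Real.pi * Complex.I * (x : ℂ))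

/-- A canonical choice of inverse of `d` modulo `c`. -/
def adInv (c d : ℕ) : ℕ := ((d : ZMod c)⁻¹).val

/-- The sum `G_{γ,n}(c; β, χ)`. -/
noncomputable def Gsum (S : Matrix (Fin m) (Fin m) ℤ) (γ : Fin m → ℚ) (n : ℚ)
    (β : Fin m → ℚ) (Nβ : ℕ) (χ : DirichletCharacter ℂ Nβ) (c : ℕ) : ℂ :=
  ∑ ν ∈ (range Nβ).filter (fun ν => Nat.Coprime ν Nβ), χ (ν : ZMod Nβ) *
    ∑ d ∈ (range c).filter (fun d => Nat.Coprime d c),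
      ∑ r ∈ Fintype.piFinset (fun _ : Fin m => range c),
        eQ (((adInv c d : ℚ) * Qf S (ν • β + fun i => (r i : ℚ))
            - bil S γ (ν • β + fun i => (r i : ℚ))
            + (d : ℚ) * (Qf S γ + n)) / c)

/-- The Gauss sum `G(χ) = ∑_{u mod N, gcd(u,N)=1} χ(u) e(u/N)`. -/
noncomputable def gaussS (N : ℕ) (χ : DirichletCharacter ℂ N) : ℂ :=
  ∑ u ∈ (range N).filter (fun u => Nat.Coprime u N), χ (u : ZMod N) * eQ (u / N)


section Exponential

theorem eQ_add (x y : ℚ) : eQ (x + y) = eQ x * eQ y := by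
  simp only [eQ, ← Complex.exp_add]
  congr 1
  push_cast
  ring

theorem eQ_intCast (z : ℤ) : eQ z = 1 := by
  rw [eQ, Complex.exp_eq_one_iff]
  exact ⟨z, by push_cast; ring⟩

theorem eQ_add_intCast (x : ℚ) (z : ℤ) : eQ (x + z) = eQ x := by
  rw [eQ_add, eQ_intCast, mul_one]

end Exponential

section Bilinear

variable (S : Matrix (Fin m) (Fin m) ℤ)

theorem bil_add_left (x y z : Fin m → ℚ) : bil S (x + y) z = bil S x z + bil S y z :=
  add_dotProduct _ _ _

theorem bil_add_right (x y z : Fin m → ℚ) : bil S x (y + z) = bil S x y + bil S x z := by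
  simp [bil, mulVec_add, dotProduct_add]

theorem bil_smul_left (a : ℚ) (x y : Fin m → ℚ) : bil S (a • x) y = a * bil S x y := by
  simp [bil]

theorem bil_smul_right (a : ℚ) (x y : Fin m → ℚ) : bil S x (a • y) = a * bil S x y := by
  simp [bil, mulVec_smul]

variable {S}

theorem bil_comm (hS : S.IsSymm) (x y : Fin m → ℚ) : bil S x y = bil S y x := by
  unfold bil
  rw [dotProduct_mulVec, dotProduct_comm, ← mulVec_transpose, ← transpose_map, hS.eq]

theorem Qf_add (hS : S.IsSymm) (x y : Fin m → ℚ) :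
    Qf S (x + y) = Qf S x + Qf S y + bil S x y := by
  simp only [Qf, bil_add_left, bil_add_right, bil_comm hS y x]
  ring

theorem Qf_smul (a : ℚ) (x : Fin m → ℚ) : Qf S (a • x) = a ^ 2 * Qf S x := by
  simp only [Qf, bil_smul_left, bil_smul_right]
  ring

/-- The vector of `ℚ^m` with the given integer coordinates. -/
def intVec (s : Fin m → ℤ) : Fin m → ℚ := fun i => s i

theorem intVec_add (s t : Fin m → ℤ) : intVec (s + t) = intVec s + intVec t := by
  ext i
  simp [intVec]

theorem exists_bil_intVec (s t : Fin m → ℤ) : ∃ z : ℤ, bil S (intVec s) (intVec t) = z :=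
  ⟨s ⬝ᵥ S.mulVec t, by simp [bil, intVec, dotProduct, mulVec]⟩

/-- An even symmetric matrix takes integral values `Q(s)` on integral vectors. -/
theorem exists_Qf_intVec (hS : S.IsSymm) (heven : ∀ i, 2 ∣ S i i) (s : Fin m → ℤ) :
    ∃ z : ℤ, Qf S (intVec s) = z := by
  rw [← Finset.univ_sum_single s]
  refine Finset.sum_induction _ (fun t => ∃ z : ℤ, Qf S (intVec t) = z) ?_ ?_ ?_
  · rintro t u ⟨a, ha⟩ ⟨b, hb⟩
    obtain ⟨c, hc⟩ := exists_bil_intVec (S := S) t u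
    exact ⟨a + b + c, by rw [intVec_add, Qf_add hS, ha, hb, hc]; push_cast; ring⟩
  · exact ⟨0, by simp [Qf, bil, intVec, dotProduct]⟩
  · intro i _
    obtain ⟨k, hk⟩ := heven i
    have hvec : intVec (Pi.single i (s i)) = Pi.single i (s i : ℚ) := by
      ext j
      by_cases h : j = i
      · subst h
        simp [intVec]
      · simp [intVec, h]
    refine ⟨s i ^ 2 * k, ?_⟩
    rw [hvec]
    simp [Qf, bil, hk]
    ring

theorem memDual.add {x y : Fin m → ℚ} (hx : memDual S x) (hy : memDual S y) :
    memDual S (x + y) := fun r => by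
  obtain ⟨a, ha⟩ := hx r
  obtain ⟨b, hb⟩ := hy r
  exact ⟨a + b, by rw [bil_add_left, ha, hb]; push_cast; ring⟩

theorem memDual.smul {x : Fin m → ℚ} (hx : memDual S x) (a : ℤ) :
    memDual S ((a : ℚ) • x) := fun r => by
  obtain ⟨b, hb⟩ := hx r
  exact ⟨a * b, by rw [bil_smul_left, hb]; push_cast; ring⟩

theorem memDual_intVec (s : Fin m → ℤ) : memDual S (intVec s) := exists_bil_intVec s

end Bilinear

section ChineseRemainder

/-- For coprime `M`, `N` and multipliers `u`, `v` prime to `M` and `N` respectively, the residue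
`u N a + v M b` modulo `M N` determined by `a` modulo `M` and `b` modulo `N`. -/
def crtMap (M N u v : ℕ) (p : ZMod M × ZMod N) : ZMod (M * N) :=
  ((u * N * p.1.val + v * M * p.2.val : ℕ) : ZMod (M * N))

variable {M N u v : ℕ} [NeZero M] [NeZero N]

theorem castHom_crtMap_left (p : ZMod M × ZMod N) :
    ZMod.castHom (dvd_mul_right M N) (ZMod M) (crtMap M N u v p) = u * N * p.1 := by
  rw [crtMap, map_natCast]
  simp

theorem castHom_crtMap_right (p : ZMod M × ZMod N) :
    ZMod.castHom (dvd_mul_left N M) (ZMod N) (crtMap M N u v p) = v * M * p.2 := by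
  rw [crtMap, map_natCast]
  simp

theorem crtMap_bijective (hMN : M.Coprime N) (hu : u.Coprime M) (hv : v.Coprime N) :
    Function.Bijective (crtMap M N u v) := by
  have : NeZero (M * N) := ⟨mul_ne_zero (NeZero.ne M) (NeZero.ne N)⟩
  rw [Fintype.bijective_iff_injective_and_card]
  refine ⟨fun p q h => Prod.ext ?_ ?_, by simp [ZMod.card]⟩
  · have h' := congrArg (ZMod.castHom (dvd_mul_right M N) (ZMod M)) h
    rw [castHom_crtMap_left, castHom_crtMap_left] at h'
    have hunit : IsUnit ((u * N : ℕ) : ZMod M) :=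
      (ZMod.isUnit_iff_coprime _ _).2 (Nat.Coprime.mul_left hu hMN.symm)
    push_cast at hunit
    exact hunit.mul_left_cancel h'
  · have h' := congrArg (ZMod.castHom (dvd_mul_left N M) (ZMod N)) h
    rw [castHom_crtMap_right, castHom_crtMap_right] at h'
    have hunit : IsUnit ((v * M : ℕ) : ZMod N) :=
      (ZMod.isUnit_iff_coprime _ _).2 (Nat.Coprime.mul_left hv hMN)
    push_cast at hunit
    exact hunit.mul_left_cancel h'

theorem exists_val_crtMap (p : ZMod M × ZMod N) :
    ∃ w : ℤ, ((crtMap M N u v p).val : ℤ) =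
      u * N * p.1.val + v * M * p.2.val + M * N * w := by
  have h : (((crtMap M N u v p).val : ℤ) : ZMod (M * N)) =
      ((u * N * p.1.val + v * M * p.2.val : ℤ) : ZMod (M * N)) := by
    have : NeZero (M * N) := ⟨mul_ne_zero (NeZero.ne M) (NeZero.ne N)⟩
    rw [Int.cast_natCast, ZMod.natCast_zmod_val, crtMap]
    push_cast
    rfl
  rw [eq_comm, ZMod.intCast_eq_intCast_iff_dvd_sub] at h
  obtain ⟨w, hw⟩ := h
  exact ⟨w, by push_cast at hw; linarith⟩

theorem sum_zmod_mul (hMN : M.Coprime N) (hu : u.Coprime M) (hv : v.Coprime N)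
    [NeZero (M * N)] (f : ZMod (M * N) → ℂ) :
    ∑ a, f a = ∑ a : ZMod M, ∑ b : ZMod N, f (crtMap M N u v (a, b)) := by
  rw [← Fintype.sum_prod_type']
  exact ((Equiv.ofBijective _ (crtMap_bijective hMN hu hv)).sum_comp f).symm

theorem sum_pi_zmod_mul (hMN : M.Coprime N) [NeZero (M * N)]
    (f : (Fin m → ZMod (M * N)) → ℂ) :
    ∑ r, f r = ∑ r : Fin m → ZMod M, ∑ s : Fin m → ZMod N,
      f (fun i => crtMap M N 1 1 (r i, s i)) := by
  rw [← Fintype.sum_prod_type']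
  let e : (Fin m → ZMod M) × (Fin m → ZMod N) ≃ (Fin m → ZMod (M * N)) :=
    (Equiv.arrowProdEquivProdArrow (Fin m) (fun _ => ZMod M) (fun _ => ZMod N)).symm.trans
      (Equiv.piCongrRight fun _ => Equiv.ofBijective _
        (crtMap_bijective hMN (Nat.coprime_one_left M) (Nat.coprime_one_left N)))
  exact (e.sum_comp f).symm

theorem sum_range_eq_sum_zmod (N : ℕ) [NeZero N] (f : ℕ → ℂ) :
    ∑ k ∈ range N, f k = ∑ a : ZMod N, f a.val := by
  refine Finset.sum_nbij' (fun k => (k : ZMod N)) ZMod.val (by simp)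
    (fun a _ => mem_range.2 a.val_lt) (fun k hk => ?_) (by simp) (fun k hk => ?_)
  · exact ZMod.val_cast_of_lt (mem_range.1 hk)
  · rw [ZMod.val_cast_of_lt (mem_range.1 hk)]

theorem sum_piFinset_range_eq_sum_zmod (N : ℕ) [NeZero N] (f : (Fin m → ℕ) → ℂ) :
    ∑ r ∈ Fintype.piFinset (fun _ : Fin m => range N), f r =
      ∑ r : Fin m → ZMod N, f fun i => (r i).val := by
  refine Finset.sum_nbij' (fun r i => (r i : ZMod N)) (fun r i => (r i).val) (by simp)
    (fun a _ => ?_) (fun r hr => ?_) (by simp) (fun r hr => ?_)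
  · simpa using fun i => (a i).val_lt
  all_goals
    have h : ∀ i, ((r i : ZMod N)).val = r i := fun i =>
      ZMod.val_cast_of_lt (mem_range.1 (Fintype.mem_piFinset.1 hr i))
    simp only [h]

end ChineseRemainder

section Terms

variable (S : Matrix (Fin m) (Fin m) ℤ) (γ : Fin m → ℚ) (n : ℚ)

/-- The argument of the exponential in `Gsum`. -/
def phase (c : ℕ) (a d : ℤ) (x : Fin m → ℚ) : ℚ :=
  (a * Qf S x - bil S γ x + d * (Qf S γ + n)) / c

/-- The summand of `Gsum`, extended by zero to all residues `d`. -/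
noncomputable def summand (c : ℕ) (d : ZMod c) (x : Fin m → ℚ) : ℂ :=
  open Classical in if IsUnit d then eQ (phase S γ n c (d⁻¹).val d.val x) else 0

/-- The sum of `summand` over `y + ℤ^m / cℤ^m`. -/
noncomputable def cosetSum (c : ℕ) [NeZero c] (d : ZMod c) (y : Fin m → ℚ) : ℂ :=
  ∑ r : Fin m → ZMod c, summand S γ n c d (y + intVec fun i => (r i).val)

theorem Gsum_eq (β : Fin m → ℚ) (N c : ℕ) [NeZero N] [NeZero c] (χ : DirichletCharacter ℂ N) :
    Gsum S γ n β N χ c =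
      ∑ ν : ZMod N, χ ν * ∑ d : ZMod c, cosetSum S γ n c d ((ν.val : ℚ) • β) := by
  unfold Gsum
  rw [sum_filter_of_ne, sum_range_eq_sum_zmod N]
  · refine Finset.sum_congr rfl fun ν _ => ?_
    rw [sum_filter, sum_range_eq_sum_zmod c, ZMod.natCast_zmod_val]
    congr 1
    refine Finset.sum_congr rfl fun d _ => ?_
    rw [sum_piFinset_range_eq_sum_zmod, cosetSum]
    by_cases h : IsUnit d
    · have h' : Nat.Coprime d.val c := by
        rwa [← ZMod.isUnit_iff_coprime, ZMod.natCast_zmod_val]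
      rw [if_pos h']
      refine Finset.sum_congr rfl fun r _ => ?_
      rw [summand, if_pos h, phase, adInv, ZMod.natCast_zmod_val, Nat.cast_smul_eq_nsmul]
      simp only [Int.cast_natCast]
      rfl
    · have h' : ¬ Nat.Coprime d.val c := by
        rwa [← ZMod.isUnit_iff_coprime, ZMod.natCast_zmod_val]
      simp [summand, h, h']
  · intro ν _ h
    by_contra hν
    rw [← ZMod.isUnit_iff_coprime] at hν
    exact h (by rw [χ.map_nonunit hν, zero_mul])

variable {S γ n}

theorem summand_add_smul_intVec (hS : S.IsSymm) (heven : ∀ i, 2 ∣ S i i) (hγ : memDual S γ)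
    {c : ℕ} [NeZero c] (d : ZMod c) {x : Fin m → ℚ} (hx : memDual S x) (s : Fin m → ℤ) :
    summand S γ n c d (x + (c : ℚ) • intVec s) = summand S γ n c d x := by
  unfold summand
  split_ifs
  · obtain ⟨k, hk⟩ := hγ s
    obtain ⟨l, hl⟩ := hx s
    obtain ⟨q, hq⟩ := exists_Qf_intVec hS heven s
    have hc : (c : ℚ) ≠ 0 := NeZero.ne _
    rw [← eQ_add_intCast (phase _ _ _ _ _ _ x) ((d⁻¹).val * (l + c * q) - k)]
    congr 1
    rw [phase, phase, Qf_add hS, Qf_smul, bil_smul_right, bil_add_right, bil_smul_right, hq]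
    unfold intVec
    rw [hk, hl]
    push_cast
    field_simp
    ring
  · rfl

theorem sum_add_lift {c : ℕ} [NeZero c] (f : (Fin m → ℤ) → ℂ)
    (hf : ∀ r s, f (r + (c : ℤ) • s) = f r) (s : Fin m → ℤ) :
    ∑ r : Fin m → ZMod c, f (s + fun i => ((r i).val : ℤ)) =
      ∑ r : Fin m → ZMod c, f fun i => ((r i).val : ℤ) := by
  refine Fintype.sum_equiv (Equiv.addLeft fun i => (s i : ZMod c)) _ _ fun r => ?_
  have h : ∀ i, ∃ w : ℤ, (((s i : ZMod c) + r i).val : ℤ) = s i + (r i).val + c * w := fun i => by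
    have h1 : (((s i + (r i).val : ℤ)) : ZMod c) = ((((s i : ZMod c) + r i).val : ℤ) : ZMod c) := by
      simp
    obtain ⟨w, hw⟩ := (ZMod.intCast_eq_intCast_iff_dvd_sub _ _ _).1 h1
    exact ⟨w, by linarith⟩
  choose w hw using h
  rw [← hf _ w]
  congr 1
  ext i
  simp [hw]

theorem cosetSum_add_intVec (hS : S.IsSymm) (heven : ∀ i, 2 ∣ S i i) (hγ : memDual S γ)
    {c : ℕ} [NeZero c] (d : ZMod c) {y : Fin m → ℚ} (hy : memDual S y) (s : Fin m → ℤ) :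
    cosetSum S γ n c d (y + intVec s) = cosetSum S γ n c d y := by
  unfold cosetSum
  have := sum_add_lift (c := c) (fun r => summand S γ n c d (y + intVec r)) (fun r t => by
    rw [← summand_add_smul_intVec hS heven hγ d (hy.add (memDual_intVec r)) t, add_assoc]
    congr 2
    ext i
    simp [intVec]) s
  simpa only [intVec_add, ← add_assoc] using this

variable {c₁ c₂ : ℕ} [NeZero c₁] [NeZero c₂]

theorem phase_mul {a a₁ a₂ d d₁ d₂ u₁ u₂ w k₁ k₂ b k : ℤ} (hS : S.IsSymm) {x₁ x₂ : Fin m → ℚ}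
    (hk : Qf S γ + n = k) (hk₁ : Qf S x₁ = k₁) (hk₂ : Qf S x₂ = k₂) (hb : bil S x₁ x₂ = b)
    (ha₁ : a * c₂ = a₁ + c₁ * u₁) (ha₂ : a * c₁ = a₂ + c₂ * u₂)
    (hd : d = c₂ * d₁ + c₁ * d₂ + c₁ * c₂ * w) :
    phase S γ n (c₁ * c₂) a d ((c₂ : ℚ) • x₁ + (c₁ : ℚ) • x₂) =
      phase S γ n c₁ a₁ d₁ x₁ + phase S γ n c₂ a₂ d₂ x₂ +
        ((u₁ * k₁ + u₂ * k₂ + a * b + w * k : ℤ) : ℚ) := by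
  have h₁ : (c₁ : ℚ) ≠ 0 := NeZero.ne _
  have h₂ : (c₂ : ℚ) ≠ 0 := NeZero.ne _
  have ha₁' : (a₁ : ℚ) = a * c₂ - c₁ * u₁ := by
    rw [eq_sub_iff_add_eq]; exact_mod_cast ha₁.symm
  have ha₂' : (a₂ : ℚ) = a * c₁ - c₂ * u₂ := by
    rw [eq_sub_iff_add_eq]; exact_mod_cast ha₂.symm
  simp only [phase, Qf_add hS, Qf_smul, bil_add_right, bil_smul_right, bil_smul_left, hk, hk₁, hk₂,
    hb, hd, ha₁', ha₂']
  push_cast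
  field_simp
  ring

theorem isUnit_crtMap_iff (hc : c₁.Coprime c₂) (p : ZMod c₁ × ZMod c₂) :
    IsUnit (crtMap c₁ c₂ 1 1 p) ↔ IsUnit p.1 ∧ IsUnit p.2 := by
  rw [crtMap, ZMod.isUnit_iff_coprime, Nat.coprime_mul_iff_right,
    ← ZMod.isUnit_iff_coprime, ← ZMod.isUnit_iff_coprime]
  have h₁ : IsUnit (c₂ : ZMod c₁) := (ZMod.isUnit_iff_coprime _ _).2 hc.symm
  have h₂ : IsUnit (c₁ : ZMod c₂) := (ZMod.isUnit_iff_coprime _ _).2 hc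
  simp [IsUnit.mul_iff, h₁, h₂]

theorem exists_val_inv_mul {M N e : ℕ} [NeZero M] [NeZero N] (h : M ∣ N) {d : ZMod N}
    (hd : IsUnit d) {d' : ZMod M} (hd' : IsUnit d')
    (hdd' : ZMod.castHom h (ZMod M) d = e * d') :
    ∃ u : ℤ, ((d⁻¹).val * e : ℤ) = (d'⁻¹).val + M * u := by
  have key : (e : ZMod M) * ZMod.castHom h (ZMod M) d⁻¹ = d'⁻¹ := by
    have h1 := congrArg (ZMod.castHom h (ZMod M)) (ZMod.mul_inv_of_unit d hd)
    rw [map_mul, hdd', map_one] at h1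
    calc (e : ZMod M) * ZMod.castHom h (ZMod M) d⁻¹
        = d'⁻¹ * (e * d' * ZMod.castHom h (ZMod M) d⁻¹) +
            (1 - d' * d'⁻¹) * (e * ZMod.castHom h (ZMod M) d⁻¹) := by ring
      _ = d'⁻¹ := by rw [h1, ZMod.mul_inv_of_unit d' hd']; ring
  have h2 : ((((d'⁻¹).val : ℤ)) : ZMod M) = (((d⁻¹).val * e : ℤ) : ZMod M) := by
    push_cast
    rw [ZMod.natCast_zmod_val, ← key, mul_comm]
    congr 1
    conv_lhs => rw [← ZMod.natCast_zmod_val d⁻¹, map_natCast]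
  obtain ⟨u, hu⟩ := (ZMod.intCast_eq_intCast_iff_dvd_sub _ _ _).1 h2
  exact ⟨u, by linarith⟩

theorem summand_mul (hS : S.IsSymm) (hn : ∃ k : ℤ, Qf S γ + n = k) (hc : c₁.Coprime c₂)
    (d₁ : ZMod c₁) (d₂ : ZMod c₂) {x₁ x₂ : Fin m → ℚ} (h₁ : ∃ k : ℤ, Qf S x₁ = k)
    (h₂ : ∃ k : ℤ, Qf S x₂ = k) (h₁₂ : ∃ b : ℤ, bil S x₁ x₂ = b) :
    summand S γ n (c₁ * c₂) (crtMap c₁ c₂ 1 1 (d₁, d₂)) ((c₂ : ℚ) • x₁ + (c₁ : ℚ) • x₂) =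
      summand S γ n c₁ d₁ x₁ * summand S γ n c₂ d₂ x₂ := by
  have : NeZero (c₁ * c₂) := ⟨mul_ne_zero (NeZero.ne c₁) (NeZero.ne c₂)⟩
  have hiff := isUnit_crtMap_iff hc (d₁, d₂)
  by_cases hd : IsUnit d₁ ∧ IsUnit d₂
  · have hu := hiff.2 hd
    obtain ⟨k, hk⟩ := hn
    obtain ⟨k₁, hk₁⟩ := h₁
    obtain ⟨k₂, hk₂⟩ := h₂
    obtain ⟨b, hb⟩ := h₁₂
    obtain ⟨u₁, hu₁⟩ := exists_val_inv_mul (e := c₂) (dvd_mul_right c₁ c₂) hu hd.1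
      (by rw [castHom_crtMap_left]; simp)
    obtain ⟨u₂, hu₂⟩ := exists_val_inv_mul (e := c₁) (dvd_mul_left c₂ c₁) hu hd.2
      (by rw [castHom_crtMap_right]; simp)
    obtain ⟨w, hw⟩ := exists_val_crtMap (u := 1) (v := 1) (d₁, d₂)
    rw [summand, summand, summand, if_pos hu, if_pos hd.1, if_pos hd.2, ← eQ_add,
      phase_mul hS hk hk₁ hk₂ hb hu₁ hu₂ (by simpa only [Nat.cast_one, one_mul] using hw),
      eQ_add_intCast]
  · rw [summand, if_neg (by rwa [hiff])]
    rcases not_and_or.1 hd with h | h <;> simp [summand, h]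

theorem cosetSum_mul (hS : S.IsSymm) (heven : ∀ i, 2 ∣ S i i) (hγ : memDual S γ)
    (hn : ∃ k : ℤ, Qf S γ + n = k) (hc : c₁.Coprime c₂) [NeZero (c₁ * c₂)]
    (d₁ : ZMod c₁) (d₂ : ZMod c₂) {y₁ y₂ : Fin m → ℚ} (hy₁ : memDual S y₁) (hy₂ : memDual S y₂)
    (h₁ : ∃ k : ℤ, Qf S y₁ = k) (h₂ : ∃ k : ℤ, Qf S y₂ = k) (h₁₂ : ∃ b : ℤ, bil S y₁ y₂ = b) :
    cosetSum S γ n (c₁ * c₂) (crtMap c₁ c₂ 1 1 (d₁, d₂)) ((c₂ : ℚ) • y₁ + (c₁ : ℚ) • y₂) =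
      cosetSum S γ n c₁ d₁ y₁ * cosetSum S γ n c₂ d₂ y₂ := by
  have hQ : ∀ {y : Fin m → ℚ}, memDual S y → (∃ k : ℤ, Qf S y = k) → ∀ s : Fin m → ℤ,
      ∃ k : ℤ, Qf S (y + intVec s) = k := by
    rintro y hy ⟨k, hk⟩ s
    obtain ⟨l, hl⟩ := exists_Qf_intVec hS heven s
    obtain ⟨b, hb⟩ := hy s
    exact ⟨k + l + b, by rw [Qf_add hS, hk, hl]; unfold intVec; rw [hb]; push_cast; ring⟩
  have hB : ∀ s t : Fin m → ℤ, ∃ b : ℤ, bil S (y₁ + intVec s) (y₂ + intVec t) = b := by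
    intro s t
    obtain ⟨b, hb⟩ := h₁₂
    obtain ⟨e, he⟩ := hy₁ t
    obtain ⟨f, hf⟩ := hy₂ s
    obtain ⟨g, hg⟩ := exists_bil_intVec (S := S) s t
    refine ⟨b + e + f + g, ?_⟩
    rw [bil_add_left, bil_add_right, bil_add_right, hb, hg, bil_comm hS (intVec s)]
    unfold intVec
    rw [he, hf]
    push_cast
    ring
  have hint : ∀ (e : ℕ) (y : Fin m → ℚ) (t : Fin m → ℤ), memDual S y →
      memDual S ((e : ℚ) • (y + intVec t)) := fun e y t hy => by
    simpa only [Int.cast_natCast] using (hy.add (memDual_intVec t)).smul e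
  unfold cosetSum
  rw [sum_pi_zmod_mul hc, Finset.sum_mul_sum]
  refine Finset.sum_congr rfl fun r _ => Finset.sum_congr rfl fun s _ => ?_
  rw [← summand_mul hS hn hc d₁ d₂ (hQ hy₁ h₁ _) (hQ hy₂ h₂ _) (hB _ _)]
  choose w hw using fun i => exists_val_crtMap (u := 1) (v := 1) (r i, s i)
  have hrs : (fun i => ((crtMap c₁ c₂ 1 1 (r i, s i)).val : ℤ)) =
      (fun i => (c₂ * (r i).val + c₁ * (s i).val : ℤ)) + ((c₁ * c₂ : ℕ) : ℤ) • w := by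
    ext i
    simp [hw]
  rw [← summand_add_smul_intVec hS heven hγ _
    ((hint c₂ y₁ (fun i => (r i).val) hy₁).add (hint c₁ y₂ (fun i => (s i).val) hy₂)) w, hrs]
  congr 1
  ext i
  simp [intVec]
  ring

end Terms

section Order

theorem isOrderOf.nsmul {β : Fin m → ℚ} {M N : ℕ} (h : isOrderOf β (M * N)) :
    isOrderOf (N • β) M := by
  obtain ⟨hpos, hint, hmin⟩ := h
  have hN : 0 < N := Nat.pos_of_mul_pos_left hpos
  refine ⟨Nat.pos_of_mul_pos_right hpos, fun i => ?_, fun k hk hki => ?_⟩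
  · obtain ⟨z, hz⟩ := hint i
    exact ⟨z, by rw [← hz]; simp [mul_assoc]⟩
  · refine Nat.le_of_mul_le_mul_right (hmin (k * N) (Nat.mul_pos hk hN) fun i => ?_) hN
    obtain ⟨z, hz⟩ := hki i
    exact ⟨z, by rw [← hz]; simp [mul_assoc]⟩

/-- If `M` is the part of `M N` supported on the primes dividing `c`, then `N` is prime to `c`. -/
theorem coprime_cofactor {c M N : ℕ} (hc : 0 < c) (hpos : 0 < M * N)
    (hM : M = ∏ p ∈ c.primeFactors, p ^ (M * N).factorization p) : c.Coprime N := by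
  refine Nat.Coprime.symm <| Nat.coprime_of_dvd fun p hp hpN hpc => ?_
  have hdvd : p ^ (M * N).factorization p ∣ M := by
    conv_rhs => rw [hM]
    exact Finset.dvd_prod_of_mem _ (Nat.mem_primeFactors.2 ⟨hp, hpc, hc.ne'⟩)
  exact Nat.pow_succ_factorization_not_dvd hpos.ne' hp (pow_succ p _ ▸ mul_dvd_mul hdvd hpN)

theorem coprime_prod_primeFactors {c k : ℕ} (f : ℕ → ℕ) (h : c.Coprime k) :
    (∏ p ∈ c.primeFactors, p ^ f p).Coprime k :=
  Nat.Coprime.prod_left fun _ hp => (h.coprime_dvd_left (Nat.dvd_of_mem_primeFactors hp)).pow_left _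

end Order

theorem changeLevel_mul_natCast {M N : ℕ} (hM : M ∣ M * N) (hN : N ∣ M * N)
    (χ₁ : DirichletCharacter ℂ M) (χ₂ : DirichletCharacter ℂ N) (k : ℕ) :
    (DirichletCharacter.changeLevel hM χ₁ * DirichletCharacter.changeLevel hN χ₂)
      (k : ZMod (M * N)) = χ₁ k * χ₂ k := by
  by_cases h : IsUnit (k : ZMod (M * N))
  · have h₁ := DirichletCharacter.changeLevel_eq_cast_of_dvd χ₁ hM h.unit
    have h₂ := DirichletCharacter.changeLevel_eq_cast_of_dvd χ₂ hN h.unit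
    rw [IsUnit.unit_spec] at h₁ h₂
    rw [MulChar.mul_apply, h₁, h₂, ZMod.cast_natCast hM, ZMod.cast_natCast hN]
  · rw [MulChar.map_nonunit _ h]
    rw [ZMod.isUnit_iff_coprime, Nat.coprime_mul_iff_right, ← ZMod.isUnit_iff_coprime,
      ← ZMod.isUnit_iff_coprime] at h
    rcases not_and_or.1 h with h | h <;> simp [MulChar.map_nonunit _ h]

/-- multiplicativity of `G_{γ,n}(c; β, χ)` in `c`. -/
theorem Gsum_multiplicative (m : ℕ) (hm : 1 ≤ m) (S : Matrix (Fin m) (Fin m) ℤ)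
    (hSsymm : S.IsSymm) (hSeven : ∀ i, 2 ∣ S i i) (hSdet : S.det ≠ 0)
    (γ : Fin m → ℚ) (hγ : memDual S γ) (n : ℚ) (hn : ∃ z : ℤ, n + Qf S γ = z)
    (β : Fin m → ℚ) (hβ : memDual S β) (hβiso : ∃ z : ℤ, Qf S β = z)
    (Nβ : ℕ) (hNβ : isOrderOf β Nβ)
    (c₁ c₂ : ℕ) (hc₁ : 0 < c₁) (hc₂ : 0 < c₂) (hc : Nat.Coprime c₁ c₂)
    (N₁ N₂ : ℕ) (hN₁ : N₁ = ∏ p ∈ c₁.primeFactors, p ^ (Nβ.factorization p))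
    (hN₂ : Nβ = N₁ * N₂)
    (hd₁ : N₁ ∣ Nβ) (hd₂ : N₂ ∣ Nβ)
    (χ : DirichletCharacter ℂ Nβ)
    (χ₁ : DirichletCharacter ℂ N₁) (χ₂ : DirichletCharacter ℂ N₂)
    (hχ : χ = DirichletCharacter.changeLevel hd₁ χ₁ * DirichletCharacter.changeLevel hd₂ χ₂) :
    isOrderOf (N₂ • β) N₁ ∧ isOrderOf (N₁ • β) N₂ ∧
      (∃ z : ℤ, Qf S (N₂ • β) = z) ∧ (∃ z : ℤ, Qf S (N₁ • β) = z) ∧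
      Gsum S γ n β Nβ χ (c₁ * c₂) =
        χ₁ ((N₂ * c₂ : ℕ) : ZMod N₁) * χ₂ ((N₁ * c₁ : ℕ) : ZMod N₂) *
          Gsum S γ n (N₂ • β) N₁ χ₁ c₁ * Gsum S γ n (N₁ • β) N₂ χ₂ c₂ := by
  subst hN₂
  have hpos := hNβ.1
  have : NeZero (N₁ * N₂) := ⟨hpos.ne'⟩
  have : NeZero N₁ := ⟨(Nat.pos_of_mul_pos_right hpos).ne'⟩
  have : NeZero N₂ := ⟨(Nat.pos_of_mul_pos_left hpos).ne'⟩
  have : NeZero c₁ := ⟨hc₁.ne'⟩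
  have : NeZero c₂ := ⟨hc₂.ne'⟩
  have : NeZero (c₁ * c₂) := ⟨(Nat.mul_pos hc₁ hc₂).ne'⟩
  have hc₁N₂ : c₁.Coprime N₂ := coprime_cofactor hc₁ hpos hN₁
  have hN₁c₂ : N₁.Coprime c₂ := hN₁ ▸ coprime_prod_primeFactors _ hc
  have hN : N₁.Coprime N₂ := by
    have := coprime_prod_primeFactors (N₁ * N₂).factorization hc₁N₂
    rwa [← hN₁] at this
  have hn' : ∃ k : ℤ, Qf S γ + n = k := hn.imp fun k hk => by rw [add_comm, hk]
  obtain ⟨q, hq⟩ := hβiso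
  have hQ : ∀ z : ℤ, ∃ k : ℤ, Qf S ((z : ℚ) • β) = k := fun z =>
    ⟨z ^ 2 * q, by rw [Qf_smul, hq]; push_cast; ring⟩
  have hB : ∀ y z : ℤ, ∃ k : ℤ, bil S ((y : ℚ) • β) ((z : ℚ) • β) = k := fun y z =>
    ⟨y * z * (2 * q), by
      rw [bil_smul_left, bil_smul_right, show bil S β β = 2 * q by rw [← hq, Qf]; ring]
      push_cast
      ring⟩
  refine ⟨hNβ.nsmul, isOrderOf.nsmul (by rwa [mul_comm]), ?_, ?_, ?_⟩
  · simpa only [Int.cast_natCast, Nat.cast_smul_eq_nsmul] using hQ N₂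
  · simpa only [Int.cast_natCast, Nat.cast_smul_eq_nsmul] using hQ N₁
  obtain ⟨s, hs⟩ : ∃ s : Fin m → ℤ, ((N₁ * N₂ : ℕ) : ℚ) • β = intVec s := by
    choose s hs using hNβ.2.1
    exact ⟨s, funext hs⟩
  have hcoset : ∀ (ν₁ : ZMod N₁) (ν₂ : ZMod N₂),
      ∑ d, cosetSum S γ n (c₁ * c₂) d (((crtMap N₁ N₂ c₂ c₁ (ν₁, ν₂)).val : ℚ) • β) =
        (∑ d, cosetSum S γ n c₁ d ((ν₁.val : ℚ) • N₂ • β)) *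
          ∑ d, cosetSum S γ n c₂ d ((ν₂.val : ℚ) • N₁ • β) := by
    intro ν₁ ν₂
    rw [sum_zmod_mul hc (Nat.coprime_one_left _) (Nat.coprime_one_left _), Finset.sum_mul_sum]
    refine Finset.sum_congr rfl fun d₁ _ => Finset.sum_congr rfl fun d₂ _ => ?_
    have e₁ : (ν₁.val : ℚ) • N₂ • β = ((ν₁.val * N₂ : ℤ) : ℚ) • β := by
      rw [← Nat.cast_smul_eq_nsmul ℚ, smul_smul]
      push_cast
      rfl
    have e₂ : (ν₂.val : ℚ) • N₁ • β = ((ν₂.val * N₁ : ℤ) : ℚ) • β := by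
      rw [← Nat.cast_smul_eq_nsmul ℚ, smul_smul]
      push_cast
      rfl
    rw [e₁, e₂, ← cosetSum_mul hSsymm hSeven hγ hn' hc d₁ d₂ (hβ.smul _) (hβ.smul _) (hQ _) (hQ _)
      (hB _ _)]
    obtain ⟨w, hw⟩ := exists_val_crtMap (u := c₂) (v := c₁) (ν₁, ν₂)
    have hw' : ((crtMap N₁ N₂ c₂ c₁ (ν₁, ν₂)).val : ℚ) =
        c₂ * N₂ * ν₁.val + c₁ * N₁ * ν₂.val + N₁ * N₂ * w := by exact_mod_cast hw
    have hmem := hβ.smul (c₂ * N₂ * ν₁.val + c₁ * N₁ * ν₂.val)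
    have harg : ((crtMap N₁ N₂ c₂ c₁ (ν₁, ν₂)).val : ℚ) • β =
        ((c₂ * N₂ * ν₁.val + c₁ * N₁ * ν₂.val : ℤ) : ℚ) • β + intVec (w • s) := by
      have hws : intVec (w • s) = (w : ℚ) • intVec s := by
        ext i
        simp [intVec]
      rw [hws, ← hs, hw', smul_smul, ← add_smul]
      congr 1
      push_cast
      ring
    rw [harg, cosetSum_add_intVec hSsymm hSeven hγ _ hmem, smul_smul, smul_smul, ← add_smul]
    congr 2
    push_cast
    ring
  have hchar : ∀ (ν₁ : ZMod N₁) (ν₂ : ZMod N₂), χ (crtMap N₁ N₂ c₂ c₁ (ν₁, ν₂)) =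
      χ₁ ((N₂ * c₂ : ℕ) : ZMod N₁) * χ₂ ((N₁ * c₁ : ℕ) : ZMod N₂) * (χ₁ ν₁ * χ₂ ν₂) := by
    intro ν₁ ν₂
    rw [hχ, crtMap, changeLevel_mul_natCast]
    simp
    ring
  rw [Gsum_eq, Gsum_eq, Gsum_eq, sum_zmod_mul hN hN₁c₂.symm hc₁N₂, mul_assoc, Finset.sum_mul_sum,
    Finset.mul_sum]
  refine Finset.sum_congr rfl fun ν₁ _ => ?_
  rw [Finset.mul_sum]
  refine Finset.sum_congr rfl fun ν₂ _ => ?_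
  rw [hcoset, hchar]
  ring

end EisensteinWeil
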